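/- Let 2 ≤ p₁ < ∞ and let s > 0 satisfy 1/s > 1/p₁. Then there exists a constant C > 0 such that for every N ∈ ℕ, sup_{n ∈ ℕ} n^{1/s} · d_n(id : ℓ_{p₁}^N → ℓ_∞^N) ≤ C · N^{1/s − 1/p₁}, where d_n denotes the n-th Kolmogorov number. -/

import Mathlib

open scoped ENNReal BigOperators

/-- The ℓ_p quasi-norm on ℝ^N, for `p : ℝ≥0∞` (with `p = ∞` giving the sup-norm). -/
noncomputable def pNorm (p : ℝ≥0∞) {N : ℕ} (x : Fin N → ℝ) : ℝ :=
  if p = ∞ then ⨆ i, |x i| else (∑ i, |x i| ^ p.toReal) ^ (1 / p.toReal)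

/-- The n-th Kolmogorov number of the identity map `id : ℓ_p^N → ℓ_q^N`. -/
noncomputable def kolmogorovNumber (p q : ℝ≥0∞) (N n : ℕ) : ℝ :=
  sInf { r : ℝ | ∃ V : Submodule ℝ (Fin N → ℝ), Module.finrank ℝ (↥V) < n ∧
    r = sSup { s : ℝ | ∃ x : Fin N → ℝ, pNorm p x ≤ 1 ∧
      s = sInf { t : ℝ | ∃ v ∈ V, t = pNorm q (x - v) } } }

/-- The n-th Gelfand number of the identity map `id : ℓ_p^N → ℓ_q^N`. -/
noncomputable def gelfandNumber (p q : ℝ≥0∞) (N n : ℕ) : ℝ :=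
  sInf { r : ℝ | ∃ M : Submodule ℝ (Fin N → ℝ), N - Module.finrank ℝ (↥M) < n ∧
    r = sSup { s : ℝ | ∃ x ∈ M, pNorm p x ≤ 1 ∧ s = pNorm q x } }

/-- The n-th approximation number of the identity map `id : ℓ_p^N → ℓ_q^N`. -/
noncomputable def approxNumber (p q : ℝ≥0∞) (N n : ℕ) : ℝ :=
  sInf { r : ℝ | ∃ L : (Fin N → ℝ) →ₗ[ℝ] (Fin N → ℝ),
    Module.finrank ℝ (↥(LinearMap.range L)) < n ∧
    r = sSup { s : ℝ | ∃ x : Fin N → ℝ, pNorm p x ≤ 1 ∧ s = pNorm q (x - L x) } }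

section KolmogorovWidth

open Real Matrix
/-- The sign `±1` encoded by a Boolean. -/
noncomputable def boolSign (b : Bool) : ℝ := if b then 1 else -1

lemma sum_boolSign_succ {N : ℕ} (x : Fin (N + 1) → ℝ) (f : ℝ → ℝ) :
    ∑ r : Fin (N + 1) → Bool, f (∑ i, boolSign (r i) * x i) =
      ∑ r : Fin N → Bool, (f (x 0 + ∑ i, boolSign (r i) * x i.succ) +
        f (-x 0 + ∑ i, boolSign (r i) * x i.succ)) := by
  rw [← (Fin.consEquiv (fun _ => Bool)).sum_comp, Fintype.sum_prod_type, Fintype.sum_bool,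
    ← Finset.sum_add_distrib]
  simp [Fin.consEquiv, Fin.sum_univ_succ, boolSign]

lemma sum_boolSign_sq {N : ℕ} (x : Fin N → ℝ) :
    ∑ r : Fin N → Bool, (∑ i, boolSign (r i) * x i) ^ 2 = 2 ^ N * ∑ i, x i ^ 2 := by
  induction N with
  | zero => simp
  | succ N ih =>
    rw [sum_boolSign_succ x (fun t => t ^ 2), Fin.sum_univ_succ, pow_succ, mul_assoc]
    have h : ∀ r : Fin N → Bool, ((x 0 + ∑ i, boolSign (r i) * x i.succ) ^ 2 +
        (-x 0 + ∑ i, boolSign (r i) * x i.succ) ^ 2) =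
        2 * x 0 ^ 2 + 2 * (∑ i, boolSign (r i) * x i.succ) ^ 2 := fun r => by ring
    rw [Finset.sum_congr rfl fun r _ => h r, Finset.sum_add_distrib, ← Finset.mul_sum Finset.univ
      (fun r : Fin N → Bool => (∑ i, boolSign (r i) * x i.succ) ^ 2), ih (fun i => x i.succ)]
    simp
    ring

lemma sum_boolSign_pow_four_le {N : ℕ} (x : Fin N → ℝ) :
    ∑ r : Fin N → Bool, (∑ i, boolSign (r i) * x i) ^ 4 ≤ 2 ^ N * (3 * (∑ i, x i ^ 2) ^ 2) := by
  induction N with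
  | zero => simp
  | succ N ih =>
    rw [sum_boolSign_succ x (fun t => t ^ 4), Fin.sum_univ_succ, pow_succ, mul_assoc]
    have h : ∀ r : Fin N → Bool, ((x 0 + ∑ i, boolSign (r i) * x i.succ) ^ 4 +
        (-x 0 + ∑ i, boolSign (r i) * x i.succ) ^ 4) =
        2 * x 0 ^ 4 + 12 * x 0 ^ 2 * (∑ i, boolSign (r i) * x i.succ) ^ 2 +
          2 * (∑ i, boolSign (r i) * x i.succ) ^ 4 := fun r => by ring
    rw [Finset.sum_congr rfl fun r _ => h r, Finset.sum_add_distrib, Finset.sum_add_distrib,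
      ← Finset.mul_sum Finset.univ
        (fun r : Fin N → Bool => (∑ i, boolSign (r i) * x i.succ) ^ 2),
      ← Finset.mul_sum Finset.univ
        (fun r : Fin N → Bool => (∑ i, boolSign (r i) * x i.succ) ^ 4), sum_boolSign_sq]
    have := ih (fun i => x i.succ)
    simp only [Finset.sum_const, Finset.card_univ, Fintype.card_fun, Fintype.card_fin,
      Fintype.card_bool, nsmul_eq_mul, Nat.cast_pow, Nat.cast_ofNat]
    have h2 : (0:ℝ) ≤ 2 ^ N * x 0 ^ 4 := by positivity
    nlinarith

lemma sum_exp_sq_boolSign_le {N : ℕ} (x : Fin N → ℝ) (l : ℝ) (hl : 0 ≤ l)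
    (h : l * (2 + 2 * ∑ i, x i ^ 2) ≤ 1) :
    ∑ r : Fin N → Bool, exp (l * (∑ i, boolSign (r i) * x i) ^ 2) ≤
      2 ^ N * exp ((∑ i, x i ^ 2) / 2) := by
  induction N generalizing l with
  | zero => simp
  | succ N ih =>
    rw [sum_boolSign_succ x (fun t => exp (l * t ^ 2))]
    rw [Fin.sum_univ_succ] at h ⊢
    set B := ∑ i : Fin N, x i.succ ^ 2 with hB
    have hB0 : 0 ≤ B := Finset.sum_nonneg fun i _ => sq_nonneg _
    have hx0 := sq_nonneg (x 0)
    have hstep : ∀ r : Fin N → Bool, exp (l * (x 0 + ∑ i, boolSign (r i) * x i.succ) ^ 2) +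
        exp (l * (-x 0 + ∑ i, boolSign (r i) * x i.succ) ^ 2) ≤
        (2 * exp (x 0 ^ 2 / 2)) *
          exp ((l + 2 * l ^ 2 * x 0 ^ 2) * (∑ i, boolSign (r i) * x i.succ) ^ 2) := by
      intro r
      set S := ∑ i, boolSign (r i) * x i.succ
      have hc := cosh_le_exp_half_sq (2 * l * S * x 0)
      have e : exp (l * (x 0 + S) ^ 2) + exp (l * (-x 0 + S) ^ 2) =
          2 * (exp (l * x 0 ^ 2) * exp (l * S ^ 2) * cosh (2 * l * S * x 0)) := by
        rw [cosh_eq, mul_div_assoc', mul_div_cancel₀ _ two_ne_zero, mul_add, ← exp_add, ← exp_add,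
          ← exp_add]
        congr 2 <;> ring
      rw [e, mul_assoc (exp (l * x 0 ^ 2)), mul_assoc (2 : ℝ) (exp (x 0 ^ 2 / 2))]
      have h1 : exp (l * x 0 ^ 2) ≤ exp (x 0 ^ 2 / 2) := by
        apply exp_le_exp.2
        nlinarith [mul_nonneg hl hx0, mul_nonneg hl hB0]
      have h2 : exp (l * S ^ 2) * cosh (2 * l * S * x 0) ≤
          exp ((l + 2 * l ^ 2 * x 0 ^ 2) * S ^ 2) := by
        calc _ ≤ exp (l * S ^ 2) * exp ((2 * l * S * x 0) ^ 2 / 2) := by gcongr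
          _ = _ := by rw [← exp_add]; congr 1; ring
      gcongr
    refine (Finset.sum_le_sum fun r _ => hstep r).trans ?_
    rw [← Finset.mul_sum]
    have hl' : (l + 2 * l ^ 2 * x 0 ^ 2) * (2 + 2 * B) ≤ 1 := by
      have h1 : l * (2 + 2 * B) ≤ 1 := by nlinarith [mul_nonneg hl hx0]
      have h2 : 0 ≤ 2 * l * x 0 ^ 2 := by positivity
      nlinarith [mul_le_mul_of_nonneg_left h1 h2]
    have := ih (fun i => x i.succ) (l + 2 * l ^ 2 * x 0 ^ 2) (by positivity) hl'
    calc _ ≤ 2 * exp (x 0 ^ 2 / 2) * (2 ^ N * exp (B / 2)) := by gcongr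
      _ = _ := by rw [add_div, exp_add]; ring

lemma exp_neg_le_quadratic {y : ℝ} (hy : 0 ≤ y) : exp (-y) ≤ 1 - y + y ^ 2 / 2 := by
  have h := quadratic_le_exp_of_nonneg hy
  rw [exp_neg, inv_le_comm₀ (exp_pos _) (by nlinarith [sq_nonneg (y - 1)])]
  refine le_trans ?_ h
  rw [inv_le_iff_one_le_mul₀ (by nlinarith [sq_nonneg (y - 1)])]
  nlinarith [sq_nonneg (y ^ 2)]

lemma sum_exp_neg_sq_boolSign_le {N : ℕ} (x : Fin N → ℝ) (hx : ∑ i, x i ^ 2 = 1) :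
    ∑ r : Fin N → Bool, exp (-((∑ i, boolSign (r i) * x i) ^ 2 / 3)) ≤
      2 ^ N * exp (-(1 / 6)) := by
  have h : ∀ r : Fin N → Bool, exp (-((∑ i, boolSign (r i) * x i) ^ 2 / 3)) ≤
      1 - 1 / 3 * (∑ i, boolSign (r i) * x i) ^ 2 +
        1 / 18 * (∑ i, boolSign (r i) * x i) ^ 4 := fun r =>
    (exp_neg_le_quadratic (by positivity)).trans (by ring_nf; rfl)
  refine (Finset.sum_le_sum fun r _ => h r).trans ?_
  rw [Finset.sum_add_distrib, Finset.sum_sub_distrib, ← Finset.mul_sum, ← Finset.mul_sum,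
    sum_boolSign_sq, hx]
  have h4 := sum_boolSign_pow_four_le x
  rw [hx] at h4
  have h5 := add_one_le_exp (-(1 / 6) : ℝ)
  have h6 : (0 : ℝ) < 2 ^ N := by positivity
  simp only [Finset.sum_const, Finset.card_univ, Fintype.card_fun, Fintype.card_fin,
      Fintype.card_bool, nsmul_eq_mul, Nat.cast_pow, Nat.cast_ofNat]
  nlinarith


lemma exists_sign_matrix (m N : ℕ) (F : Finset (Fin N → ℝ)) (hF : ∀ x ∈ F, ∑ i, x i ^ 2 = 1)
    (hcard : 2 * (F.card : ℝ) * exp (-(m / 12)) < 1) :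
    ∃ A : Matrix (Fin m) (Fin N) ℝ, ∀ x ∈ F,
      m / 4 ≤ ∑ j, (A *ᵥ x) j ^ 2 ∧ ∑ j, (A *ᵥ x) j ^ 2 ≤ 4 * m := by
  let Z : (Fin N → Bool) → (Fin N → ℝ) → ℝ := fun r x => ∑ i, boolSign (r i) * x i
  let g : (Fin m → Fin N → Bool) → (Fin N → ℝ) → ℝ := fun A x =>
    exp (m / 12) * ∏ j, exp (-(Z (A j) x ^ 2 / 3)) + exp (-m) * ∏ j, exp (1 / 4 * Z (A j) x ^ 2)
  have hg : ∀ x ∈ F, ∑ A, g A x ≤ ((2 : ℝ) ^ N) ^ m * (2 * exp (-(m / 12))) := by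
    intro x hx
    simp only [g]
    rw [Finset.sum_add_distrib, ← Finset.mul_sum, ← Finset.mul_sum,
      ← Fintype.sum_pow (fun r => exp (-(Z r x ^ 2 / 3))),
      ← Fintype.sum_pow (fun r => exp (1 / 4 * Z r x ^ 2))]
    have h1 := sum_exp_neg_sq_boolSign_le x (hF x hx)
    have h2 := sum_exp_sq_boolSign_le x (1 / 4) (by norm_num) (by rw [hF x hx]; norm_num)
    rw [hF x hx] at h2
    calc _ ≤ exp (m / 12) * (2 ^ N * exp (-(1 / 6))) ^ m +
          exp (-m) * (2 ^ N * exp (1 / 2)) ^ m := by gcongr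
      _ = ((2 : ℝ) ^ N) ^ m * (exp (-(m / 12)) + exp (-(m / 2))) := by
        have e1 : exp (-((m : ℝ) / 12)) = exp (m / 12) * exp (-(1 / 6)) ^ m := by
          rw [← exp_nat_mul, ← exp_add]; congr 1; ring
        have e2 : exp (-((m : ℝ) / 2)) = exp (-m) * exp (1 / 2) ^ m := by
          rw [← exp_nat_mul, ← exp_add]; congr 1; ring
        rw [e1, e2]; ring
      _ ≤ _ := by
        have : exp (-((m : ℝ) / 2)) ≤ exp (-(m / 12)) := by
          apply exp_le_exp.2
          have : (0 : ℝ) ≤ m := m.cast_nonneg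
          linarith
        rw [two_mul]; gcongr
  have hlt : ∑ A, ∑ x ∈ F, g A x < ∑ _A : Fin m → Fin N → Bool, (1 : ℝ) := by
    rw [Finset.sum_comm]
    calc _ ≤ ∑ _x ∈ F, ((2 : ℝ) ^ N) ^ m * (2 * exp (-(m / 12))) := Finset.sum_le_sum hg
      _ = ((2 : ℝ) ^ N) ^ m * (2 * (F.card : ℝ) * exp (-(m / 12))) := by
        rw [Finset.sum_const, nsmul_eq_mul]; ring
      _ < ((2 : ℝ) ^ N) ^ m * 1 := by gcongr
      _ = _ := by simp
  obtain ⟨A, -, hA⟩ := Finset.exists_lt_of_sum_lt hlt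
  refine ⟨fun j i => boolSign (A j i), fun x hx => ?_⟩
  have hgx : g A x < 1 := by
    refine lt_of_le_of_lt (Finset.single_le_sum (f := fun x => g A x) (fun x _ => ?_) hx) hA
    simp only [g]; positivity
  have hS : ∀ j, ((fun j i => boolSign (A j i) : Matrix (Fin m) (Fin N) ℝ) *ᵥ x) j = Z (A j) x :=
    fun j => rfl
  simp only [hS]
  simp only [g, ← exp_sum, ← exp_add, Finset.sum_neg_distrib, ← Finset.sum_div,
    ← Finset.mul_sum] at hgx
  constructor
  · have := exp_lt_one_iff.1 (lt_of_le_of_lt (le_add_of_nonneg_right (exp_pos _).le) hgx)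
    linarith
  · have := exp_lt_one_iff.1 (lt_of_le_of_lt (le_add_of_nonneg_left (exp_pos _).le) hgx)
    linarith

/-- Integer vectors of `ℓ₁`-norm at most `K`. -/
noncomputable def intBall (N K : ℕ) : Finset (Fin N → ℤ) :=
  (Fintype.piFinset fun _ => Finset.Icc (-(K : ℤ)) K).filter fun u => ∑ i, |u i| ≤ K

lemma mem_intBall {N K : ℕ} {u : Fin N → ℤ} : u ∈ intBall N K ↔ ∑ i, |u i| ≤ K := by
  rw [intBall, Finset.mem_filter, and_iff_right_iff_imp]
  intro h
  simp only [Fintype.mem_piFinset, Finset.mem_Icc, ← abs_le]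
  exact fun i => (Finset.single_le_sum (f := fun i => |u i|)
    (fun i _ => abs_nonneg _) (Finset.mem_univ i)).trans h

lemma sum_Icc_pow_natAbs_le (K : ℕ) {x : ℝ} (hx : 0 ≤ x) (hx2 : x ≤ 1 / 2) :
    ∑ j ∈ Finset.Icc (-(K : ℤ)) K, x ^ j.natAbs ≤ 1 + 4 * x - 4 * x ^ (K + 1) := by
  induction K with
  | zero => simp
  | succ K ih =>
    have h : Finset.Icc (-((K + 1 : ℕ) : ℤ)) (K + 1 : ℕ) =
        insert (-((K : ℤ) + 1)) (insert ((K : ℤ) + 1) (Finset.Icc (-(K : ℤ)) K)) := by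
      ext j; simp only [Finset.mem_Icc, Finset.mem_insert]; omega
    rw [h, Finset.sum_insert (by simp only [Finset.mem_Icc, Finset.mem_insert]; omega),
      Finset.sum_insert (by simp only [Finset.mem_Icc]; omega)]
    have h1 : (-((K : ℤ) + 1)).natAbs = K + 1 := by omega
    have h2 : ((K : ℤ) + 1).natAbs = K + 1 := by omega
    rw [h1, h2, pow_succ x (K + 1)]
    nlinarith [pow_nonneg hx (K + 1)]

lemma card_intBall_le (N K : ℕ) {x : ℝ} (hx : 0 < x) (hx2 : x ≤ 1 / 2) :
    ((intBall N K).card : ℝ) * x ^ K ≤ exp (4 * x * N) := by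
  calc ((intBall N K).card : ℝ) * x ^ K = ∑ _u ∈ intBall N K, x ^ K := by simp
    _ ≤ ∑ u ∈ intBall N K, ∏ i, x ^ (u i).natAbs := by
      refine Finset.sum_le_sum fun u hu => ?_
      rw [Finset.prod_pow_eq_pow_sum]
      refine pow_le_pow_of_le_one hx.le (by linarith) ?_
      have := mem_intBall.1 hu
      zify
      exact this
    _ ≤ ∑ u ∈ Fintype.piFinset fun _ : Fin N => Finset.Icc (-(K : ℤ)) K,
          ∏ i, x ^ (u i).natAbs :=
      Finset.sum_le_sum_of_subset_of_nonneg (Finset.filter_subset _ _)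
        fun u _ _ => Finset.prod_nonneg fun i _ => pow_nonneg hx.le _
    _ = (∑ j ∈ Finset.Icc (-(K : ℤ)) K, x ^ j.natAbs) ^ N := by
      rw [Finset.sum_pow']
    _ ≤ (exp (4 * x)) ^ N := by
      gcongr
      have := sum_Icc_pow_natAbs_le K hx.le hx2
      have := add_one_le_exp (4 * x)
      have := pow_pos hx (K + 1)
      linarith
    _ = exp (4 * x * N) := by rw [← exp_nat_mul]; ring_nf

lemma exists_sign_matrix_intBall (m N K : ℕ)
    (hcard : 2 * ((intBall N K).card : ℝ) * exp (-(m / 12)) < 1) :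
    ∃ A : Matrix (Fin m) (Fin N) ℝ, ∀ u ∈ intBall N K,
      m / 4 * ∑ i, (u i : ℝ) ^ 2 ≤ ∑ j, (A *ᵥ fun i => (u i : ℝ)) j ^ 2 ∧
      ∑ j, (A *ᵥ fun i => (u i : ℝ)) j ^ 2 ≤ 4 * m * ∑ i, (u i : ℝ) ^ 2 := by
  classical
  let φ : (Fin N → ℤ) → Fin N → ℝ := fun u => (√(∑ i, (u i : ℝ) ^ 2))⁻¹ • fun i => (u i : ℝ)
  have hpos : ∀ u : Fin N → ℤ, u ≠ 0 → 0 < ∑ i, (u i : ℝ) ^ 2 := by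
    intro u hu
    obtain ⟨i, hi⟩ := Function.ne_iff.1 hu
    have hi' : (u i : ℝ) ≠ 0 := by exact_mod_cast hi
    exact Finset.sum_pos' (fun i _ => sq_nonneg _) ⟨i, Finset.mem_univ _, by positivity⟩
  obtain ⟨A, hA⟩ := exists_sign_matrix m N (((intBall N K).erase 0).image φ) (by
    intro x hx
    obtain ⟨u, hu, rfl⟩ := Finset.mem_image.1 hx
    have := hpos u (Finset.ne_of_mem_erase hu)
    simp only [φ, Pi.smul_apply, smul_eq_mul, mul_pow, ← Finset.mul_sum, inv_pow,
      sq_sqrt this.le]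
    exact inv_mul_cancel₀ this.ne') (by
    refine lt_of_le_of_lt ?_ hcard
    gcongr
    exact Finset.card_image_le.trans (Finset.card_le_card (Finset.erase_subset _ _)))
  refine ⟨A, fun u hu => ?_⟩
  rcases eq_or_ne u 0 with rfl | h0
  · have h0 : (fun _ : Fin N => (0 : ℝ)) = 0 := rfl
    simp [h0]
  · have hp := hpos u h0
    have h := hA (φ u) (Finset.mem_image_of_mem _ (Finset.mem_erase.2 ⟨h0, hu⟩))
    simp only [φ, mulVec_smul, Pi.smul_apply, smul_eq_mul, mul_pow, ← Finset.mul_sum, inv_pow,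
      sq_sqrt hp.le] at h
    rw [inv_mul_eq_div, le_div_iff₀ hp, div_le_iff₀ hp] at h
    exact h

lemma exists_sparse_sign {N K : ℕ} (hK : 1 ≤ K) (h w : Fin N → ℝ) (hw : ∀ i, |w i| ≤ 1)
    (hw1 : ∑ i, |w i| ≤ K) :
    ∃ v ∈ intBall N K, ∑ i, (v i : ℝ) ^ 2 ≤ K ∧ ∑ i, h i * w i ≤ ∑ i, h i * (v i : ℝ) := by
  classical
  suffices H : ∃ S : Finset (Fin N), S.card ≤ K ∧ ∑ i, |h i| * |w i| ≤ ∑ i ∈ S, |h i| by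
    obtain ⟨S, hS, hle⟩ := H
    refine ⟨fun i => if i ∈ S then (if 0 ≤ h i then 1 else -1) else 0, mem_intBall.2 ?_, ?_, ?_⟩
    · have : ∀ i, |if i ∈ S then (if 0 ≤ h i then (1 : ℤ) else -1) else 0| =
          if i ∈ S then 1 else 0 := by
        intro i; split_ifs <;> simp
      simpa [this] using hS
    · have : ∀ i, (((if i ∈ S then (if 0 ≤ h i then (1 : ℤ) else -1) else 0 : ℤ) : ℝ)) ^ 2 =
          if i ∈ S then 1 else 0 := by
        intro i; split_ifs <;> simp
      simpa [this] using hS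
    · have : ∀ i, h i * ((if i ∈ S then (if 0 ≤ h i then (1 : ℤ) else -1) else 0 : ℤ) : ℝ) =
          if i ∈ S then |h i| else 0 := by
        intro i
        split_ifs with h1 h2
        · simp [abs_of_nonneg h2]
        · simp [abs_of_neg (not_le.1 h2)]
        · simp
      simp only [this, Finset.sum_ite_mem, Finset.univ_inter]
      refine le_trans (Finset.sum_le_sum fun i _ => ?_) hle
      rw [← abs_mul]; exact le_abs_self _
  rcases le_total N K with hNK | hKN
  · refine ⟨Finset.univ, by simpa using hNK, Finset.sum_le_sum fun i _ => ?_⟩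
    exact mul_le_of_le_one_right (abs_nonneg _) (hw i)
  · obtain ⟨S, hS, hmax⟩ := Finset.exists_max_image
      (Finset.powersetCard K (Finset.univ : Finset (Fin N))) (fun S => ∑ i ∈ S, |h i|)
      (Finset.powersetCard_nonempty.2 (by simpa using hKN))
    have hcard := (Finset.mem_powersetCard.1 hS).2
    obtain ⟨i₀, hi₀, hmin⟩ := Finset.exists_min_image S (fun i => |h i|)
      (Finset.card_pos.1 (by omega))
    refine ⟨S, hcard.le, ?_⟩
    have hout : ∀ j ∈ Sᶜ, |h j| ≤ |h i₀| := by
      intro j hj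
      have hj : j ∉ S := Finset.mem_compl.1 hj
      have hj' : j ∉ S.erase i₀ := fun h' => hj (Finset.mem_of_mem_erase h')
      have := hmax (insert j (S.erase i₀)) (Finset.mem_powersetCard.2
        ⟨Finset.subset_univ _, by
          rw [Finset.card_insert_of_notMem hj', Finset.card_erase_of_mem hi₀]; omega⟩)
      simp only [Finset.sum_insert hj'] at this
      have := Finset.add_sum_erase S (fun i => |h i|) hi₀
      linarith
    rw [← Finset.sum_add_sum_compl S] at hw1 ⊢
    have h1 : ∑ i ∈ Sᶜ, |h i| * |w i| ≤ |h i₀| * ∑ i ∈ Sᶜ, |w i| := by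
      rw [Finset.mul_sum]
      exact Finset.sum_le_sum fun j hj => mul_le_mul_of_nonneg_right (hout j hj) (abs_nonneg _)
    have h2 : |h i₀| * (K - ∑ i ∈ S, |w i|) ≤ ∑ i ∈ S, |h i| * (1 - |w i|) := by
      have : (K : ℝ) - ∑ i ∈ S, |w i| = ∑ i ∈ S, (1 - |w i|) := by
        rw [Finset.sum_sub_distrib]; simp [hcard]
      rw [this, Finset.mul_sum]
      exact Finset.sum_le_sum fun j hj =>
        mul_le_mul_of_nonneg_right (hmin j hj) (sub_nonneg.2 (hw j))
    have h3 : |h i₀| * ∑ i ∈ Sᶜ, |w i| ≤ |h i₀| * (K - ∑ i ∈ S, |w i|) :=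
      mul_le_mul_of_nonneg_left (by linarith) (abs_nonneg _)
    have h4 : ∑ i ∈ S, |h i| * (1 - |w i|) = ∑ i ∈ S, |h i| - ∑ i ∈ S, |h i| * |w i| := by
      rw [← Finset.sum_sub_distrib]; exact Finset.sum_congr rfl fun i _ => by ring
    linarith

lemma sum_mulVec_sq_le_of_intBall {m N K : ℕ} (hK : 1 ≤ K) (A : Matrix (Fin m) (Fin N) ℝ)
    {b : ℝ} (hb : 0 ≤ b) (hA : ∀ u ∈ intBall N K,
      ∑ j, (A *ᵥ fun i => (u i : ℝ)) j ^ 2 ≤ b * ∑ i, (u i : ℝ) ^ 2)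
    (w : Fin N → ℝ) (hw : ∀ i, |w i| ≤ 1) (hw1 : ∑ i, |w i| ≤ K) :
    ∑ j, (A *ᵥ w) j ^ 2 ≤ b * K := by
  obtain ⟨v, hv, hvK, hle⟩ := exists_sparse_sign hK (Aᵀ *ᵥ (A *ᵥ w)) w hw hw1
  have key : ∀ z : Fin N → ℝ,
      ∑ i, (Aᵀ *ᵥ (A *ᵥ w)) i * z i = ∑ j, (A *ᵥ w) j * (A *ᵥ z) j := by
    intro z
    change (Aᵀ *ᵥ (A *ᵥ w)) ⬝ᵥ z = (A *ᵥ w) ⬝ᵥ (A *ᵥ z)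
    rw [mulVec_transpose, dotProduct_mulVec]
  rw [key, key] at hle
  have hcs := Finset.sum_mul_sq_le_sq_mul_sq Finset.univ (A *ᵥ w) (A *ᵥ fun i => (v i : ℝ))
  have hX : ∑ j, (A *ᵥ w) j * (A *ᵥ w) j = ∑ j, (A *ᵥ w) j ^ 2 :=
    Finset.sum_congr rfl fun j _ => (sq _).symm
  rw [hX] at hle
  have hX0 : 0 ≤ ∑ j, (A *ᵥ w) j ^ 2 := Finset.sum_nonneg fun j _ => sq_nonneg _
  have hY : ∑ j, (A *ᵥ fun i => (v i : ℝ)) j ^ 2 ≤ b * K :=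
    (hA v hv).trans (mul_le_mul_of_nonneg_left hvK hb)
  rcases hX0.eq_or_lt with h0 | h0
  · rw [← h0]; positivity
  · have := (pow_le_pow_left₀ hX0 hle 2).trans hcs
    rw [sq] at this
    exact (le_of_mul_le_mul_left this h0).trans hY

lemma sum_sq_le_of_mulVec_eq_zero {m N K : ℕ} (hm : 1 ≤ m) (hK : 1 ≤ K)
    (A : Matrix (Fin m) (Fin N) ℝ) (hA : ∀ u ∈ intBall N K,
      m / 4 * ∑ i, (u i : ℝ) ^ 2 ≤ ∑ j, (A *ᵥ fun i => (u i : ℝ)) j ^ 2 ∧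
      ∑ j, (A *ᵥ fun i => (u i : ℝ)) j ^ 2 ≤ 4 * m * ∑ i, (u i : ℝ) ^ 2)
    (y : Fin N → ℝ) (hy : A *ᵥ y = 0) :
    ∑ i, y i ^ 2 ≤ 36 / K * (∑ i, |y i|) ^ 2 := by
  have hm' : (0 : ℝ) < m := by exact_mod_cast hm
  have hK' : (0 : ℝ) < K := by exact_mod_cast hK
  have hL0 : 0 ≤ ∑ i, |y i| := Finset.sum_nonneg fun i _ => abs_nonneg _
  rcases hL0.eq_or_lt with h0 | hL
  · have hy0 : ∀ i, y i = 0 := fun i => abs_eq_zero.1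
      ((Finset.sum_eq_zero_iff_of_nonneg fun i _ => abs_nonneg _).1 h0.symm i (Finset.mem_univ i))
    simp [hy0]
  set L := ∑ i, |y i| with hLdef
  have hd : 0 < L / K := by positivity
  set z : Fin N → ℝ := fun i => y i / (L / K) with hz
  have hzL : ∑ i, |z i| = K := by
    simp only [hz, abs_div, abs_of_pos hd, ← Finset.sum_div, ← hLdef]
    field_simp
  have hAz : A *ᵥ z = 0 := by
    have : z = (L / K)⁻¹ • y := by ext i; simp [hz, div_eq_inv_mul]
    rw [this, mulVec_smul, hy, smul_zero]
  have round : ∀ t : ℝ, ∃ k : ℤ, |(k : ℝ)| ≤ |t| ∧ |t - k| ≤ 1 ∧ |t - k| ≤ |t| := by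
    intro t
    rcases le_total 0 t with ht | ht
    · have h1 := Int.floor_le t
      have h2 := Int.lt_floor_add_one t
      have h3 : (0 : ℝ) ≤ ⌊t⌋ := by exact_mod_cast Int.floor_nonneg.2 ht
      refine ⟨⌊t⌋, ?_, ?_, ?_⟩
      · rw [abs_of_nonneg ht, abs_of_nonneg h3]; exact h1
      · rw [abs_of_nonneg (by linarith)]; linarith
      · rw [abs_of_nonneg (by linarith), abs_of_nonneg ht]; linarith
    · have h1 := Int.le_ceil t
      have h2 := Int.ceil_lt_add_one t
      have h3 : (⌈t⌉ : ℝ) ≤ 0 := by exact_mod_cast Int.ceil_le.2 (by simpa using ht)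
      refine ⟨⌈t⌉, ?_, ?_, ?_⟩
      · rw [abs_of_nonpos ht, abs_of_nonpos h3]; linarith
      · rw [abs_of_nonpos (by linarith)]; linarith
      · rw [abs_of_nonpos (by linarith), abs_of_nonpos ht]; linarith
  choose k hk1 hk2 hk3 using round
  set u : Fin N → ℤ := fun i => k (z i) with hu
  set w : Fin N → ℝ := fun i => z i - u i with hwdef
  have humem : u ∈ intBall N K := by
    rw [mem_intBall]
    have : ∑ i, |(u i : ℝ)| ≤ K := hzL ▸ Finset.sum_le_sum fun i _ => hk1 (z i)
    exact_mod_cast this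
  have hwK : ∑ i, |w i| ≤ K := hzL ▸ Finset.sum_le_sum fun i _ => hk3 (z i)
  have hAw := sum_mulVec_sq_le_of_intBall hK A (by positivity) (fun u hu => (hA u hu).2) w
    (fun i => hk2 (z i)) hwK
  have hAeq : A *ᵥ w = -(A *ᵥ fun i => (u i : ℝ)) := by
    have : w = z - fun i => (u i : ℝ) := rfl
    rw [this, mulVec_sub, hAz, zero_sub]
  have hAu := (hA u humem).1
  simp only [hAeq, Pi.neg_apply, neg_sq] at hAw
  have husq : ∑ i, (u i : ℝ) ^ 2 ≤ 16 * K := by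
    have := hAu.trans hAw
    have h' : m / 4 * ∑ i, (u i : ℝ) ^ 2 ≤ m / 4 * (16 * K) := by linarith
    exact le_of_mul_le_mul_left h' (by positivity)
  have hwsq : ∑ i, w i ^ 2 ≤ K := by
    refine le_trans (Finset.sum_le_sum fun i _ => ?_) hwK
    rw [← sq_abs, sq]
    exact mul_le_of_le_one_left (abs_nonneg _) (hk2 (z i))
  have hzsq : ∑ i, z i ^ 2 ≤ 36 * K := by
    have : ∑ i, z i ^ 2 ≤ ∑ i, (2 * (u i : ℝ) ^ 2 + 2 * w i ^ 2) := by
      refine Finset.sum_le_sum fun i _ => ?_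
      simp only [hwdef]
      nlinarith [sq_nonneg ((u i : ℝ) - (z i - u i))]
    rw [Finset.sum_add_distrib, ← Finset.mul_sum, ← Finset.mul_sum] at this
    linarith
  have hyz : ∑ i, y i ^ 2 = (L / K) ^ 2 * ∑ i, z i ^ 2 := by
    rw [Finset.mul_sum]
    refine Finset.sum_congr rfl fun i _ => ?_
    rw [← mul_pow, hz, mul_div_cancel₀ _ hd.ne']
  rw [hyz]
  calc _ ≤ (L / K) ^ 2 * (36 * K) := by gcongr
    _ = _ := by field_simp

lemma exists_mem_forall_abs_sub_le {N : ℕ} (V : Submodule ℝ (Fin N → ℝ)) (x : Fin N → ℝ) {R : ℝ}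
    (hR : 0 ≤ R) (h : ∀ y : Fin N → ℝ, (∀ v ∈ V, v ⬝ᵥ y = 0) → x ⬝ᵥ y ≤ R * ∑ i, |y i|) :
    ∃ v ∈ V, ∀ i, |x i - v i| ≤ R := by
  by_contra! hcon
  have hdisj : Disjoint (Metric.closedBall x R) (V : Set (Fin N → ℝ)) := by
    rw [Set.disjoint_left]
    intro v hv hvV
    obtain ⟨i, hi⟩ := hcon v hvV
    rw [Metric.mem_closedBall, dist_comm, dist_pi_le_iff hR] at hv
    exact absurd (hv i) (not_le.2 (by rwa [Real.dist_eq]))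
  obtain ⟨f, a, b, hfa, hab, hfb⟩ := geometric_hahn_banach_compact_closed (convex_closedBall x R)
    (isCompact_closedBall x R) V.convex V.closed_of_finiteDimensional hdisj
  have hb0 : b < 0 := by simpa using hfb 0 V.zero_mem
  have hfV : ∀ v ∈ V, f v = 0 := by
    intro v hv
    by_contra hne
    have := hfb ((b / f v) • v) (V.smul_mem _ hv)
    rw [map_smul, smul_eq_mul, div_mul_cancel₀ _ hne] at this
    exact lt_irrefl _ this
  set y : Fin N → ℝ := fun i => -f (Pi.single i 1) with hy
  have hfy : ∀ v, f v = -(v ⬝ᵥ y) := by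
    intro v
    have := LinearMap.pi_apply_eq_sum_univ (f : (Fin N → ℝ) →ₗ[ℝ] ℝ) v
    simp only [ContinuousLinearMap.coe_coe, smul_eq_mul] at this
    rw [this, dotProduct, ← Finset.sum_neg_distrib]
    refine Finset.sum_congr rfl fun i _ => ?_
    simp only [hy, mul_neg, neg_neg]
    congr 2
    ext j
    simp [Pi.single_apply, eq_comm]
  have hxy := h y fun v hv => by have := hfV v hv; rw [hfy] at this; linarith
  set e : Fin N → ℝ := fun i => if 0 ≤ y i then 1 else -1 with he
  have hmem : x - R • e ∈ Metric.closedBall x R := by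
    rw [Metric.mem_closedBall, dist_pi_le_iff hR]
    intro i
    simp only [he, Real.dist_eq, Pi.sub_apply, Pi.smul_apply, smul_eq_mul, sub_sub_cancel_left]
    split_ifs <;> simp [abs_of_nonneg hR]
  have hey : e ⬝ᵥ y = ∑ i, |y i| := by
    refine Finset.sum_congr rfl fun i _ => ?_
    simp only [he]
    split_ifs with h0
    · rw [one_mul, abs_of_nonneg h0]
    · rw [abs_of_neg (not_le.1 h0)]; ring
  have := hfa _ hmem
  rw [hfy, sub_dotProduct, smul_dotProduct, hey, smul_eq_mul] at this
  linarith

lemma dotProduct_le_of_sum_rpow_le_one {N : ℕ} {p T : ℝ} (hp : 2 ≤ p) (hT : 0 < T)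
    (x y : Fin N → ℝ) (hx : ∑ i, |x i| ^ p ≤ 1)
    (hy : ∑ i, y i ^ 2 ≤ T * (∑ i, |y i|) ^ 2) :
    x ⬝ᵥ y ≤ 2 * T ^ (1 / p) * ∑ i, |y i| := by
  set t := T ^ (1 / p) with ht
  have ht0 : 0 < t := rpow_pos_of_pos hT _
  have hL0 : 0 ≤ ∑ i, |y i| := Finset.sum_nonneg fun i _ => abs_nonneg _
  set g : Fin N → ℝ := fun i => if |x i| ≤ t then 0 else |x i| with hg
  have hxy : x ⬝ᵥ y ≤ t * ∑ i, |y i| + ∑ i, g i * |y i| := by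
    rw [Finset.mul_sum, ← Finset.sum_add_distrib]
    refine Finset.sum_le_sum fun i _ => ?_
    refine (le_abs_self _).trans ?_
    rw [abs_mul, ← add_mul]
    refine mul_le_mul_of_nonneg_right ?_ (abs_nonneg _)
    simp only [hg]
    split_ifs <;> linarith
  have hg2 : ∑ i, g i ^ 2 ≤ t ^ (2 - p) := by
    have : ∑ i, g i ^ 2 ≤ ∑ i, t ^ (2 - p) * |x i| ^ p := by
      refine Finset.sum_le_sum fun i _ => ?_
      simp only [hg]
      split_ifs with h
      · rw [zero_pow two_ne_zero]; positivity
      · have hxi : 0 < |x i| := ht0.trans (not_le.1 h)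
        calc |x i| ^ 2 = |x i| ^ (2 - p) * |x i| ^ p := by
              rw [← rpow_add hxi, sub_add_cancel, rpow_two]
          _ ≤ _ := mul_le_mul_of_nonneg_right
            (rpow_le_rpow_of_nonpos ht0 (not_le.1 h).le (by linarith)) (by positivity)
    rw [← Finset.mul_sum] at this
    exact this.trans (mul_le_of_le_one_right (by positivity) hx)
  have hTt : t ^ (2 - p) * T = t ^ 2 := by
    have : t ^ p = T := by
      rw [ht, ← rpow_mul hT.le, one_div_mul_cancel (by linarith), rpow_one]
    rw [← this, ← rpow_add ht0, sub_add_cancel, rpow_two]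
  have hgy : ∑ i, g i * |y i| ≤ t * ∑ i, |y i| := by
    refine abs_le_of_sq_le_sq' ?_ (by positivity) |>.2
    calc _ ≤ (∑ i, g i ^ 2) * ∑ i, |y i| ^ 2 := Finset.sum_mul_sq_le_sq_mul_sq _ _ _
      _ ≤ t ^ (2 - p) * (T * (∑ i, |y i|) ^ 2) := by
        simp only [sq_abs]
        gcongr
      _ = _ := by rw [← mul_assoc, hTt]; ring
  linarith

lemma kolmogorovNumber_top_le {p : ℝ≥0∞} {N n : ℕ} {R : ℝ} (hR : 0 ≤ R)
    (V : Submodule ℝ (Fin N → ℝ)) (hV : Module.finrank ℝ V < n)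
    (h : ∀ x : Fin N → ℝ, pNorm p x ≤ 1 → ∃ v ∈ V, ∀ i, |x i - v i| ≤ R) :
    kolmogorovNumber p ∞ N n ≤ R := by
  have hnn : ∀ z : Fin N → ℝ, 0 ≤ pNorm ∞ z := by
    intro z
    simp only [pNorm, if_true]
    exact Real.iSup_nonneg fun i => abs_nonneg _
  have hinf : ∀ (W : Submodule ℝ (Fin N → ℝ)) (x : Fin N → ℝ),
      0 ≤ sInf {t : ℝ | ∃ v ∈ W, t = pNorm ∞ (x - v)} := by
    intro W x
    refine Real.sInf_nonneg ?_
    rintro _ ⟨v, -, rfl⟩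
    exact hnn _
  rw [kolmogorovNumber]
  refine le_trans (csInf_le ⟨0, ?_⟩ ⟨V, hV, rfl⟩) (Real.sSup_le ?_ hR)
  · rintro _ ⟨W, -, rfl⟩
    refine Real.sSup_nonneg ?_
    rintro _ ⟨x, -, rfl⟩
    exact hinf W x
  · rintro _ ⟨x, hx, rfl⟩
    obtain ⟨v, hv, hvR⟩ := h x hx
    refine le_trans (csInf_le ⟨0, ?_⟩ ⟨v, hv, rfl⟩) ?_
    · rintro _ ⟨v, -, rfl⟩
      exact hnn _
    · simp only [pNorm, if_true]
      exact Real.iSup_le (fun i => hvR i) hR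

lemma sum_rpow_le_one_of_pNorm_le_one {N : ℕ} {p : ℝ} (hp : 0 < p) {x : Fin N → ℝ}
    (hx : pNorm (ENNReal.ofReal p) x ≤ 1) : ∑ i, |x i| ^ p ≤ 1 := by
  simp only [pNorm, ENNReal.ofReal_ne_top, if_false, ENNReal.toReal_ofReal hp.le] at hx
  by_contra! hlt
  exact absurd hx (not_le.2 (one_lt_rpow hlt (one_div_pos.2 hp)))

lemma kolmogorovNumber_le_one {N n : ℕ} {p : ℝ} (hp : 0 < p) (hn : 1 ≤ n) :
    kolmogorovNumber (ENNReal.ofReal p) ∞ N n ≤ 1 := by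
  refine kolmogorovNumber_top_le zero_le_one ⊥ (by rw [finrank_bot]; omega) fun x hx => ⟨0, by simp, ?_⟩
  intro i
  have h := (Finset.single_le_sum (f := fun i => |x i| ^ p) (fun i _ => by positivity)
    (Finset.mem_univ i)).trans (sum_rpow_le_one_of_pNorm_le_one hp hx)
  rw [Pi.zero_apply, sub_zero]
  by_contra! hlt
  exact absurd h (not_le.2 (one_lt_rpow hlt hp))

lemma kolmogorovNumber_nonpos_of_lt {N n : ℕ} {p : ℝ≥0∞} (hn : N < n) :
    kolmogorovNumber p ∞ N n ≤ 0 :=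
  kolmogorovNumber_top_le le_rfl ⊤ (by simpa using hn) fun x _ => ⟨x, by simp, by simp⟩

lemma kolmogorovNumber_le_of_card {N m K : ℕ} {p : ℝ} (hp : 2 ≤ p) (hm : 1 ≤ m) (hK : 1 ≤ K)
    (hcard : 2 * ((intBall N K).card : ℝ) * exp (-(m / 12)) < 1) :
    kolmogorovNumber (ENNReal.ofReal p) ∞ N (m + 1) ≤ 2 * (36 / K) ^ (1 / p) := by
  obtain ⟨A, hA⟩ := exists_sign_matrix_intBall m N K hcard
  have hK' : (0 : ℝ) < K := by exact_mod_cast hK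
  refine kolmogorovNumber_top_le (by positivity) (LinearMap.range Aᵀ.mulVecLin) ?_ fun x hx => ?_
  · have := LinearMap.finrank_range_le Aᵀ.mulVecLin
    rw [Module.finrank_fin_fun] at this
    omega
  · refine exists_mem_forall_abs_sub_le _ x (by positivity) fun y hy => ?_
    have hAy : A *ᵥ y = 0 := by
      have := hy (Aᵀ *ᵥ (A *ᵥ y)) ⟨A *ᵥ y, rfl⟩
      rw [mulVec_transpose, ← dotProduct_mulVec] at this
      exact dotProduct_self_eq_zero.1 this
    exact dotProduct_le_of_sum_rpow_le_one hp (by positivity) x y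
      (sum_rpow_le_one_of_pNorm_le_one (by linarith) hx)
      (sum_sq_le_of_mulVec_eq_zero hm hK A hA y hAy)

lemma exists_card_intBall_lt {δ : ℝ} (hδ : 0 < δ) :
    ∃ c : ℝ, 0 < c ∧ c ≤ 1 / 2 ∧ ∀ N m K : ℕ, m + 1 ≤ N → 1 ≤ K →
      (K : ℝ) ≤ c * (m + 1) * ((N : ℝ) / (m + 1)) ^ (-δ) →
      2 * ((intBall N K).card : ℝ) * exp (-(m / 12)) < 1 := by
  set B : ℝ := 8 + 1 / δ with hB
  have hB8 : 8 < B := by have := one_div_pos.2 hδ; linarith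
  set q : ℝ := 1 / (24 * B) with hq
  have hq0 : 0 < q := by positivity
  have hqB : q * B = 1 / 24 := by rw [hq]; field_simp
  have hq1 : q ≤ 1 / 2 := by nlinarith
  have hc2 : q ^ 2 ≤ 1 / 2 := by nlinarith
  refine ⟨q ^ 2, by positivity, hc2, fun N m K hmN hK hKκ => ?_⟩
  set n : ℝ := m + 1 with hn
  have hn0 : 0 < n := by positivity
  have hnN : n ≤ N := by rw [hn]; exact_mod_cast hmN
  have hN0 : (0 : ℝ) < N := hn0.trans_le hnN
  set t : ℝ := N / n with ht
  have ht1 : 1 ≤ t := (one_le_div hn0).2 hnN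
  have ht0 : 0 < t := by linarith
  set κ : ℝ := q ^ 2 * n * t ^ (-δ) with hκ
  have hK1 : (1 : ℝ) ≤ K := by exact_mod_cast hK
  have hκ1 : 1 ≤ κ := hK1.trans hKκ
  have hκ0 : 0 < κ := by linarith
  have htδ : t ^ (-δ) ≤ 1 := rpow_le_one_of_one_le_of_nonpos ht1 (by linarith)
  have hκn : κ ≤ q ^ 2 * n := mul_le_of_le_one_right (by positivity) htδ
  have hnm : n ≤ 2 * m := by
    have : (2 : ℝ) ≤ n := by nlinarith
    linarith
  set x : ℝ := κ / N with hx
  have hx0 : 0 < x := by positivity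
  have hx2 : x ≤ 1 / 2 := by
    rw [hx, div_le_iff₀ hN0]
    nlinarith
  have hlogx : -log x = -log (q ^ 2) + (1 + δ) * log t := by
    have hxt : x = q ^ 2 * t ^ (-δ) * t⁻¹ := by
      rw [hx, hκ, ht]; field_simp
    rw [hxt, log_mul (by positivity) (by positivity), log_mul (by positivity) (by positivity),
      log_rpow ht0, log_inv]
    ring
  have hlogq : -log (q ^ 2) ≤ 2 / q := by
    have := log_le_sub_one_of_pos (inv_pos.2 hq0)
    rw [log_inv] at this
    rw [log_pow, Nat.cast_ofNat, div_eq_mul_inv]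
    linarith
  have hlogt : κ * log t ≤ q ^ 2 * n / δ := by
    have h1 := log_le_rpow_div ht0.le hδ
    calc κ * log t ≤ κ * (t ^ δ / δ) := by gcongr
      _ = q ^ 2 * n / δ * (t ^ (-δ) * t ^ δ) := by rw [hκ]; ring
      _ = q ^ 2 * n / δ := by rw [← rpow_add ht0]; simp
  have hmain : κ * (5 - log x) ≤ m / 12 := by
    have h1 : κ * (5 - log x) = κ * (5 - log (q ^ 2)) + (1 + δ) * (κ * log t) := by
      rw [sub_eq_add_neg, hlogx]; ring
    have h2 : κ * (5 - log (q ^ 2)) ≤ q ^ 2 * n * (5 + 2 / q) :=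
      (mul_le_mul_of_nonneg_left (by linarith) hκ0.le).trans
        (mul_le_mul_of_nonneg_right hκn (by positivity))
    have h3 : (1 + δ) * (κ * log t) ≤ (1 + δ) * (q ^ 2 * n / δ) :=
      mul_le_mul_of_nonneg_left hlogt (by linarith)
    have h4 : q ^ 2 * n * (5 + 2 / q) + (1 + δ) * (q ^ 2 * n / δ) =
        n * (q ^ 2 * (B - 2) + 2 * q) := by
      rw [hB]; field_simp; ring
    have h5 : q ^ 2 * (B - 2) + 2 * q ≤ 1 / 24 := by nlinarith
    have h6 := mul_le_mul_of_nonneg_left h5 hn0.le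
    linarith
  have hcard := card_intBall_le N K hx0 hx2
  have hxN : 4 * x * N = 4 * κ := by rw [hx]; field_simp
  have hxK : exp (κ * log x) ≤ x ^ K := by
    rw [← rpow_natCast, rpow_def_of_pos hx0, exp_le_exp, mul_comm κ]
    exact mul_le_mul_of_nonpos_left hKκ (log_nonpos hx0.le (by linarith))
  have hcard' : ((intBall N K).card : ℝ) ≤ exp (4 * κ - κ * log x) := by
    rw [exp_sub, le_div_iff₀ (exp_pos _), ← hxN]
    exact (mul_le_mul_of_nonneg_left hxK (Nat.cast_nonneg _)).trans hcard
  have h2 : (2 : ℝ) < exp κ := by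
    have := add_one_lt_exp hκ0.ne'
    linarith
  calc 2 * ((intBall N K).card : ℝ) * exp (-(m / 12))
      ≤ 2 * exp (4 * κ - κ * log x) * exp (-(m / 12)) := by gcongr
    _ < exp κ * exp (4 * κ - κ * log x) * exp (-(m / 12)) := by gcongr
    _ = exp (κ * (5 - log x) - m / 12) := by rw [← exp_add, ← exp_add]; congr 1; ring
    _ ≤ 1 := exp_le_one_iff.2 (by linarith)

lemma kolmogorovNumber_le_rpow {p δ : ℝ} (hp : 2 ≤ p) (hδ : 0 < δ) :
    ∃ c : ℝ, 0 < c ∧ ∀ N n : ℕ, 1 ≤ n → n ≤ N →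
      kolmogorovNumber (ENNReal.ofReal p) ∞ N n ≤
        2 * (c * ((n : ℝ)⁻¹ * ((N : ℝ) / n) ^ δ)) ^ (1 / p) := by
  obtain ⟨c, hc, hc2, H⟩ := exists_card_intBall_lt hδ
  have hp0 : 0 < p := by linarith
  refine ⟨72 / c, by positivity, fun N n hn hnN => ?_⟩
  obtain ⟨m, rfl⟩ : ∃ m, n = m + 1 := ⟨n - 1, by omega⟩
  have hnN' : ((m + 1 : ℕ) : ℝ) ≤ N := by exact_mod_cast hnN
  have hn0 : (0 : ℝ) < (m + 1 : ℕ) := by positivity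
  have ht1 : 1 ≤ (N : ℝ) / (m + 1 : ℕ) := (one_le_div hn0).2 hnN'
  have ht0 : 0 < (N : ℝ) / (m + 1 : ℕ) := by linarith
  set κ : ℝ := c * (m + 1 : ℕ) * ((N : ℝ) / (m + 1 : ℕ)) ^ (-δ) with hκ
  have hκ0 : 0 < κ := by positivity
  have hκe : 72 / c * (((m + 1 : ℕ) : ℝ)⁻¹ * ((N : ℝ) / (m + 1 : ℕ)) ^ δ) = 72 / κ := by
    rw [hκ, rpow_neg ht0.le]; field_simp
  rw [hκe]
  rcases lt_or_ge κ 1 with hlt | hge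
  · refine (kolmogorovNumber_le_one hp0 hn).trans ?_
    have : 1 ≤ (72 / κ) ^ (1 / p) :=
      one_le_rpow ((one_le_div hκ0).2 (by linarith)) (by positivity)
    linarith
  · have hK1 : 1 ≤ ⌊κ⌋₊ := Nat.one_le_floor_iff κ |>.2 hge
    have hK1' : (1 : ℝ) ≤ ⌊κ⌋₊ := by exact_mod_cast hK1
    have hKκ := Nat.floor_le hκ0.le
    have hκK := Nat.lt_floor_add_one κ
    have hm : 1 ≤ m := by
      by_contra! h0
      obtain rfl : m = 0 := by omega
      have : ((N : ℝ) / (0 + 1 : ℕ)) ^ (-δ) ≤ 1 :=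
        rpow_le_one_of_one_le_of_nonpos ht1 (by linarith)
      rw [hκ] at hge
      simp only [zero_add, Nat.cast_one, mul_one] at hge this
      nlinarith
    refine (kolmogorovNumber_le_of_card hp hm hK1
      (H N m ⌊κ⌋₊ hnN hK1 (by rw [hκ] at hKκ ⊢; push_cast at hKκ ⊢; exact hKκ))).trans ?_
    gcongr 2 * ?_ ^ (1 / p)
    rw [div_le_div_iff₀ (by linarith) hκ0]
    linarith

end KolmogorovWidth

/-- For `2 ≤ p₁ < ∞` and `1/s > 1/p₁` there is `C > 0` with
`sup_n n^{1/s}·d_n(id : ℓ_{p₁}^N → ℓ_∞^N) ≤ C·N^{1/s - 1/p₁}` for every `N`. -/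
theorem kolmogorov_ideal_norm_large_p (p₁ s : ℝ) (hp1 : 2 ≤ p₁)
    (hs : 0 < s) (hs2 : 1/p₁ < 1/s) :
    ∃ C : ℝ, 0 < C ∧ ∀ N n : ℕ, 1 ≤ n →
      (n : ℝ) ^ (1/s) * kolmogorovNumber (ENNReal.ofReal p₁) ∞ N n ≤
        C * (N : ℝ) ^ (1/s - 1/p₁) := by
  have hp0 : 0 < p₁ := by linarith
  have hε : 0 < 1 / s - 1 / p₁ := by linarith
  obtain ⟨c, hc, H⟩ := kolmogorovNumber_le_rpow hp1 (mul_pos hp0 hε)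
  refine ⟨2 * c ^ (1 / p₁), by positivity, fun N n hn => ?_⟩
  have hn0 : (0 : ℝ) < n := by exact_mod_cast hn
  rcases lt_or_ge N n with hlt | hge
  · exact (mul_nonpos_of_nonneg_of_nonpos (by positivity)
      (kolmogorovNumber_nonpos_of_lt hlt)).trans (by positivity)
  have hN0 : (0 : ℝ) < N := hn0.trans_le (by exact_mod_cast hge)
  refine (mul_le_mul_of_nonneg_left (H N n hn hge) (by positivity)).trans_eq ?_
  have hexp : p₁ * (1 / s - 1 / p₁) * (1 / p₁) = 1 / s - 1 / p₁ := by field_simp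
  rw [Real.mul_rpow hc.le (by positivity), Real.mul_rpow (by positivity) (by positivity),
    ← Real.rpow_mul (by positivity), hexp, Real.div_rpow hN0.le hn0.le, Real.inv_rpow hn0.le,
    Real.rpow_sub hn0]
  field_simp
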